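/- arXiv:2310.14698 — 2 statements merged into one kernel-verified Lean document; each statement's English description precedes it below -/
import Mathlib

section
/- A couple (Σ_{2,1,2,2}, Ω), where Ω is a 6-letter word with three letters P and three letters N, is realizable if and only if Ω is one of the six orders PNNPPN, NPPPNN, NPPNPN, NPPNNP, NPNPPN, NNPPPN. Explicitly: for each of these six orders there exist reals as in the setup realizing the sign pattern (+,+,−,+,+,−,−) with that order of moduli, and conversely every monic degree-6 hyperbolic polynomial with pairwise distinct moduli of roots and coefficient signs (+,+,−,+,+,−,−) has its order of moduli equal to one of these six. -/
open Polynomial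

/-- The monic degree-6 hyperbolic polynomial with positive roots `α1, α2, α3`
and negative roots `-γ1, -γ2, -γ3`. -/
noncomputable def hp6 (α1 α2 α3 γ1 γ2 γ3 : ℝ) : Polynomial ℝ :=
  (X - C α1) * (X - C α2) * (X - C α3) * (X + C γ1) * (X + C γ2) * (X + C γ3)

/-- The six moduli, listed in increasing order, form the word `Ω`
(`true` = letter `P`, i.e. the modulus of a positive root;
`false` = letter `N`, i.e. the modulus of a negative root). -/
def hasOrder (α1 α2 α3 γ1 γ2 γ3 : ℝ) (Ω : Fin 6 → Bool) : Prop :=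
  ∃ m : Fin 6 → ℝ, StrictMono m ∧
    Set.range m = ({α1, α2, α3, γ1, γ2, γ3} : Set ℝ) ∧
    ∀ i : Fin 6, (Ω i = true ↔ (m i = α1 ∨ m i = α2 ∨ m i = α3))

/-- `p` has the sign pattern `σ` read from the leading coefficient (index `0` of `σ`,
coefficient of `x^6`) to the constant term (`true` = `+`, `false` = `-`). -/
def hasSigns (p : Polynomial ℝ) (σ : Fin 7 → Bool) : Prop :=
  ∀ j : Fin 7, p.coeff (6 - (j : ℕ)) ≠ 0 ∧ (0 < p.coeff (6 - (j : ℕ)) ↔ σ j = true)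

/-- The couple (sign pattern `σ`, order of moduli `Ω`) is realizable by a monic
degree-6 hyperbolic polynomial with pairwise distinct moduli of roots. -/
def realizable (σ : Fin 7 → Bool) (Ω : Fin 6 → Bool) : Prop :=
  ∃ α1 α2 α3 γ1 γ2 γ3 : ℝ,
    0 < α1 ∧ α1 < α2 ∧ α2 < α3 ∧ 0 < γ1 ∧ γ1 < γ2 ∧ γ2 < γ3 ∧
    α1 ≠ γ1 ∧ α1 ≠ γ2 ∧ α1 ≠ γ3 ∧ α2 ≠ γ1 ∧ α2 ≠ γ2 ∧ α2 ≠ γ3 ∧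
    α3 ≠ γ1 ∧ α3 ≠ γ2 ∧ α3 ≠ γ3 ∧
    hasOrder α1 α2 α3 γ1 γ2 γ3 Ω ∧
    hasSigns (hp6 α1 α2 α3 γ1 γ2 γ3) σ

/-- For distinct moduli, a word is the order of moduli as soon as it agrees with one
strictly increasing enumeration of the moduli. -/
lemma hasOrder_iff_of_strictMono {α1 α2 α3 γ1 γ2 γ3 : ℝ} {Ω : Fin 6 → Bool} {m : Fin 6 → ℝ}
    (hm : StrictMono m) (hr : Set.range m = ({α1, α2, α3, γ1, γ2, γ3} : Set ℝ)) :
    hasOrder α1 α2 α3 γ1 γ2 γ3 Ω ↔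
      ∀ i, (Ω i = true ↔ (m i = α1 ∨ m i = α2 ∨ m i = α3)) := by
  refine ⟨?_, fun h => ⟨m, hm, hr, h⟩⟩
  rintro ⟨m', hm', hr', h⟩
  rwa [(hm'.range_inj hm).1 (hr'.trans hr.symm)] at h

lemma strictMono_vec6 {a b c d e f : ℝ} (hab : a < b) (hbc : b < c) (hcd : c < d) (hde : d < e)
    (hef : e < f) : StrictMono ![a, b, c, d, e, f] := by
  rw [Fin.strictMono_iff_lt_succ]
  intro i
  fin_cases i <;> simpa

lemma range_vec6 (a b c d e f : ℝ) :
    Set.range ![a, b, c, d, e, f] = ({a, b, c, d, e, f} : Set ℝ) := by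
  simp only [Matrix.range_cons, Matrix.range_empty, Set.union_empty, Set.singleton_union]

/-- The order of moduli of an explicitly ordered family of moduli. -/
lemma hasOrder_iff_eq {α1 α2 α3 γ1 γ2 γ3 a b c d e f : ℝ} {Ω Ω' : Fin 6 → Bool}
    (hab : a < b) (hbc : b < c) (hcd : c < d) (hde : d < e) (hef : e < f)
    (hr : ({a, b, c, d, e, f} : Set ℝ) = {α1, α2, α3, γ1, γ2, γ3})
    (hΩ' : ∀ i, (Ω' i = true ↔ (![a, b, c, d, e, f] i = α1 ∨ ![a, b, c, d, e, f] i = α2 ∨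
      ![a, b, c, d, e, f] i = α3))) :
    hasOrder α1 α2 α3 γ1 γ2 γ3 Ω ↔ Ω = Ω' := by
  rw [hasOrder_iff_of_strictMono (strictMono_vec6 hab hbc hcd hde hef) ((range_vec6 ..).trans hr)]
  constructor
  · intro h
    funext i
    rw [Bool.eq_iff_iff, h i, hΩ' i]
  · rintro rfl
    exact hΩ'

lemma hasSigns_hp6_iff (α1 α2 α3 γ1 γ2 γ3 : ℝ) :
    hasSigns (hp6 α1 α2 α3 γ1 γ2 γ3) ![true, true, false, true, true, false, false] ↔
      0 < (γ1 + γ2 + γ3) - (α1 + α2 + α3) ∧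
      (γ1 * γ2 + γ1 * γ3 + γ2 * γ3) - (α1 + α2 + α3) * (γ1 + γ2 + γ3)
        + (α1 * α2 + α1 * α3 + α2 * α3) < 0 ∧
      0 < γ1 * γ2 * γ3 - (α1 + α2 + α3) * (γ1 * γ2 + γ1 * γ3 + γ2 * γ3)
        + (α1 * α2 + α1 * α3 + α2 * α3) * (γ1 + γ2 + γ3) - α1 * α2 * α3 ∧
      0 < (α1 * α2 + α1 * α3 + α2 * α3) * (γ1 * γ2 + γ1 * γ3 + γ2 * γ3)
        - (α1 + α2 + α3) * (γ1 * γ2 * γ3) - α1 * α2 * α3 * (γ1 + γ2 + γ3) ∧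
      (α1 * α2 + α1 * α3 + α2 * α3) * (γ1 * γ2 * γ3)
        - α1 * α2 * α3 * (γ1 * γ2 + γ1 * γ3 + γ2 * γ3) < 0 ∧
      -(α1 * α2 * α3 * (γ1 * γ2 * γ3)) < 0 := by
  have expand : ∀ c5 c4 c3 c2 c1 c0 : ℝ,
      hasSigns (X ^ 6 + C c5 * X ^ 5 + C c4 * X ^ 4 + C c3 * X ^ 3 + C c2 * X ^ 2 + C c1 * X + C c0)
        ![true, true, false, true, true, false, false] ↔
      0 < c5 ∧ c4 < 0 ∧ 0 < c3 ∧ 0 < c2 ∧ c1 < 0 ∧ c0 < 0 := by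
    intro c5 c4 c3 c2 c1 c0
    simp [hasSigns, Fin.forall_fin_succ, coeff_X, coeff_C, coeff_X_pow]
    grind
  rw [← expand]
  congr! 1
  simp only [hp6, map_sub, map_add, map_mul, map_neg]
  ring

/-- If `α ≤ γ` termwise then the reciprocals of the `α`s have the larger sum. -/
lemma esymm_two_mul_le_of_le {α1 α2 α3 γ1 γ2 γ3 : ℝ} (hα1 : 0 < α1) (hα2 : 0 < α2) (hα3 : 0 < α3)
    (h1 : α1 ≤ γ1) (h2 : α2 ≤ γ2) (h3 : α3 ≤ γ3) :
    α1 * α2 * α3 * (γ1 * γ2 + γ1 * γ3 + γ2 * γ3) ≤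
      (α1 * α2 + α1 * α3 + α2 * α3) * (γ1 * γ2 * γ3) := by
  have hγ1 := hα1.trans_le h1
  have hγ2 := hα2.trans_le h2
  have hγ3 := hα3.trans_le h3
  have t1 : 0 ≤ (γ1 - α1) * (α2 * α3 * γ2 * γ3) := mul_nonneg (sub_nonneg.2 h1) (by positivity)
  have t2 : 0 ≤ (γ2 - α2) * (α1 * α3 * γ1 * γ3) := mul_nonneg (sub_nonneg.2 h2) (by positivity)
  have t3 : 0 ≤ (γ3 - α3) * (α1 * α2 * γ1 * γ2) := mul_nonneg (sub_nonneg.2 h3) (by positivity)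
  linarith

/-- Weak majorization: if the `α`s spread wider than the `γ`s and have the smaller sum, then the
reciprocals of the `α`s have the larger sum. -/
lemma esymm_two_mul_le_of_spread {α1 α2 α3 γ1 γ2 γ3 : ℝ} (hα1 : 0 < α1) (hα12 : α1 ≤ α2)
    (hα23 : α2 ≤ α3) (hγ12 : γ1 ≤ γ2) (hγ23 : γ2 ≤ γ3) (h1 : α1 ≤ γ1) (h3 : γ3 ≤ α3)
    (hs : α1 + α2 + α3 ≤ γ1 + γ2 + γ3) :
    α1 * α2 * α3 * (γ1 * γ2 + γ1 * γ3 + γ2 * γ3) ≤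
      (α1 * α2 + α1 * α3 + α2 * α3) * (γ1 * γ2 * γ3) := by
  have hα2 := hα1.trans_le hα12
  have hα3 := hα2.trans_le hα23
  have hγ1 := hα1.trans_le h1
  have hγ2 := hγ1.trans_le hγ12
  have hγ3 := hγ2.trans_le hγ23
  have w12 : α1 * γ1 ≤ α2 * γ2 := by gcongr
  have w23 : α2 * γ2 ≤ α3 * γ3 := by gcongr
  have t1 : 0 ≤ (γ1 - α1) * (α3 * γ3 * (α2 * γ2 - α1 * γ1)) :=
    mul_nonneg (by linarith) (mul_nonneg (by positivity) (by linarith))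
  have t2 : 0 ≤ (γ1 + γ2 - α1 - α2) * (α1 * γ1 * (α3 * γ3 - α2 * γ2)) :=
    mul_nonneg (by linarith) (mul_nonneg (by positivity) (by linarith))
  have t3 : 0 ≤ (γ1 + γ2 + γ3 - α1 - α2 - α3) * (α1 * γ1 * (α2 * γ2)) :=
    mul_nonneg (by linarith) (by positivity)
  linarith

/-- The interlacings of two increasing triples which are neither comparable termwise nor such that
the first one spreads wider than the second. -/
lemma interlacing_cases {α1 α2 α3 γ1 γ2 γ3 : ℝ} (hα12 : α1 < α2)
    (n11 : α1 ≠ γ1) (n12 : α1 ≠ γ2) (n22 : α2 ≠ γ2) (n32 : α3 ≠ γ2) (n33 : α3 ≠ γ3)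
    (hle : ¬ (α1 ≤ γ1 ∧ α2 ≤ γ2 ∧ α3 ≤ γ3)) (hge : ¬ (γ1 ≤ α1 ∧ γ2 ≤ α2 ∧ γ3 ≤ α3))
    (hsp : ¬ (α1 ≤ γ1 ∧ γ3 ≤ α3)) :
    (α1 < γ1 ∧ γ2 < α2 ∧ α3 < γ3) ∨ (γ1 < α1 ∧ α3 < γ2) ∨
      (γ1 < α1 ∧ α2 < γ2 ∧ γ2 < α3 ∧ α3 < γ3) ∨ (γ1 < α1 ∧ α2 < γ2 ∧ γ3 < α3) ∨
      (γ1 < α1 ∧ α1 < γ2 ∧ γ2 < α2 ∧ α3 < γ3) ∨ (γ2 < α1 ∧ α3 < γ3) := by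
  rcases n11.lt_or_gt with h11 | h11
  · have h33 : α3 < γ3 := by
      by_contra! h
      exact hsp ⟨h11.le, h⟩
    have h22 : γ2 < α2 := by
      by_contra! h
      exact hle ⟨h11.le, h, h33.le⟩
    exact .inl ⟨h11, h22, h33⟩
  have h33 : γ2 < α2 → α3 < γ3 := by
    intro h
    by_contra! h'
    exact hge ⟨h11.le, h.le, h'⟩
  rcases n12.lt_or_gt with h12 | h12
  · rcases n22.lt_or_gt with h22 | h22
    · rcases n32.lt_or_gt with h32 | h32
      · exact .inr (.inl ⟨h11, h32⟩)
      · rcases n33.lt_or_gt with h | h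
        · exact .inr (.inr (.inl ⟨h11, h22, h32, h⟩))
        · exact .inr (.inr (.inr (.inl ⟨h11, h22, h⟩)))
    · exact .inr (.inr (.inr (.inr (.inl ⟨h11, h12, h22, h33 h22⟩))))
  · exact .inr (.inr (.inr (.inr (.inr ⟨h12, h33 (h12.trans hα12)⟩))))

/-- The necessary conditions on the moduli given by the coefficients of `x ^ 5` and `x`. -/
lemma interlacing_of_hasSigns {α1 α2 α3 γ1 γ2 γ3 : ℝ} (hα1 : 0 < α1) (hα12 : α1 < α2)
    (hα23 : α2 < α3) (hγ12 : γ1 < γ2) (hγ23 : γ2 < γ3)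
    (n11 : α1 ≠ γ1) (n12 : α1 ≠ γ2) (n22 : α2 ≠ γ2) (n32 : α3 ≠ γ2) (n33 : α3 ≠ γ3)
    (hsig : hasSigns (hp6 α1 α2 α3 γ1 γ2 γ3) ![true, true, false, true, true, false, false]) :
    (α1 < γ1 ∧ γ2 < α2 ∧ α3 < γ3) ∨ (γ1 < α1 ∧ α3 < γ2) ∨
      (γ1 < α1 ∧ α2 < γ2 ∧ γ2 < α3 ∧ α3 < γ3) ∨ (γ1 < α1 ∧ α2 < γ2 ∧ γ3 < α3) ∨
      (γ1 < α1 ∧ α1 < γ2 ∧ γ2 < α2 ∧ α3 < γ3) ∨ (γ2 < α1 ∧ α3 < γ3) := by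
  rw [hasSigns_hp6_iff] at hsig
  obtain ⟨hc5, -, -, -, hc1, -⟩ := hsig
  have hα2 := hα1.trans hα12
  have hα3 := hα2.trans hα23
  have hle : ¬ (α1 ≤ γ1 ∧ α2 ≤ γ2 ∧ α3 ≤ γ3) := fun ⟨h1, h2, h3⟩ => by
    linarith [esymm_two_mul_le_of_le hα1 hα2 hα3 h1 h2 h3]
  have hge : ¬ (γ1 ≤ α1 ∧ γ2 ≤ α2 ∧ γ3 ≤ α3) := fun ⟨h1, h2, h3⟩ => by linarith
  have hsp : ¬ (α1 ≤ γ1 ∧ γ3 ≤ α3) := fun ⟨h1, h3⟩ => by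
    linarith [esymm_two_mul_le_of_spread hα1 hα12.le hα23.le hγ12.le hγ23.le h1 h3 (by linarith)]
  exact interlacing_cases hα12 n11 n12 n22 n32 n33 hle hge hsp

/-- The couple `(Σ_{2,1,2,2}, Ω)` is realizable iff `Ω` is one of
`PNNPPN`, `NPPPNN`, `NPPNPN`, `NPPNNP`, `NPNPPN`, `NNPPPN`. -/
theorem sigma2122_realizable_orders (Ω : Fin 6 → Bool)
    (hΩ : (Finset.univ.filter fun i => Ω i = true).card = 3) :
    realizable ![true, true, false, true, true, false, false] Ω ↔
      (Ω = ![true, false, false, true, true, false] ∨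
       Ω = ![false, true, true, true, false, false] ∨
       Ω = ![false, true, true, false, true, false] ∨
       Ω = ![false, true, true, false, false, true] ∨
       Ω = ![false, true, false, true, true, false] ∨
       Ω = ![false, false, true, true, true, false]) := by
  constructor
  · rintro ⟨α1, α2, α3, γ1, γ2, γ3, hα1, hα12, hα23, hγ1, hγ12, hγ23, n11, n12, n13, n21, n22, n23,
      n31, n32, n33, hord, hsig⟩
    rcases interlacing_of_hasSigns hα1 hα12 hα23 hγ12 hγ23 n11 n12 n22 n32 n33 hsig with
      ⟨h1, h2, h3⟩ | ⟨h1, h2⟩ | ⟨h1, h2, h3, h4⟩ | ⟨h1, h2, h3⟩ | ⟨h1, h2, h3, h4⟩ | ⟨h1, h2⟩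
    · have h := (hasOrder_iff_eq (a := α1) (b := γ1) (c := γ2) (d := α2) (e := α3)
        (f := γ3) (Ω' := ![true, false, false, true, true, false])
        (by linarith) (by linarith) (by linarith) (by linarith) (by linarith)
        (by ext; simp only [Set.mem_insert_iff, Set.mem_singleton_iff]; clear * -; tauto)
        (by simp [Fin.forall_fin_succ, n11.symm, n12.symm, n13.symm, n21.symm, n22.symm, n23.symm,
          n31.symm, n32.symm, n33.symm])).1 hord
      simp [h]
    · have h := (hasOrder_iff_eq (a := γ1) (b := α1) (c := α2) (d := α3) (e := γ2)
        (f := γ3) (Ω' := ![false, true, true, true, false, false])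
        (by linarith) (by linarith) (by linarith) (by linarith) (by linarith)
        (by ext; simp only [Set.mem_insert_iff, Set.mem_singleton_iff]; clear * -; tauto)
        (by simp [Fin.forall_fin_succ, n11.symm, n12.symm, n13.symm, n21.symm, n22.symm, n23.symm,
          n31.symm, n32.symm, n33.symm])).1 hord
      simp [h]
    · have h := (hasOrder_iff_eq (a := γ1) (b := α1) (c := α2) (d := γ2) (e := α3)
        (f := γ3) (Ω' := ![false, true, true, false, true, false])
        (by linarith) (by linarith) (by linarith) (by linarith) (by linarith)
        (by ext; simp only [Set.mem_insert_iff, Set.mem_singleton_iff]; clear * -; tauto)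
        (by simp [Fin.forall_fin_succ, n11.symm, n12.symm, n13.symm, n21.symm, n22.symm, n23.symm,
          n31.symm, n32.symm, n33.symm])).1 hord
      simp [h]
    · have h := (hasOrder_iff_eq (a := γ1) (b := α1) (c := α2) (d := γ2) (e := γ3)
        (f := α3) (Ω' := ![false, true, true, false, false, true])
        (by linarith) (by linarith) (by linarith) (by linarith) (by linarith)
        (by ext; simp only [Set.mem_insert_iff, Set.mem_singleton_iff]; clear * -; tauto)
        (by simp [Fin.forall_fin_succ, n11.symm, n12.symm, n13.symm, n21.symm, n22.symm, n23.symm,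
          n31.symm, n32.symm, n33.symm])).1 hord
      simp [h]
    · have h := (hasOrder_iff_eq (a := γ1) (b := α1) (c := γ2) (d := α2) (e := α3)
        (f := γ3) (Ω' := ![false, true, false, true, true, false])
        (by linarith) (by linarith) (by linarith) (by linarith) (by linarith)
        (by ext; simp only [Set.mem_insert_iff, Set.mem_singleton_iff]; clear * -; tauto)
        (by simp [Fin.forall_fin_succ, n11.symm, n12.symm, n13.symm, n21.symm, n22.symm, n23.symm,
          n31.symm, n32.symm, n33.symm])).1 hord
      simp [h]
    · have h := (hasOrder_iff_eq (a := γ1) (b := γ2) (c := α1) (d := α2) (e := α3)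
        (f := γ3) (Ω' := ![false, false, true, true, true, false])
        (by linarith) (by linarith) (by linarith) (by linarith) (by linarith)
        (by ext; simp only [Set.mem_insert_iff, Set.mem_singleton_iff]; clear * -; tauto)
        (by simp [Fin.forall_fin_succ, n11.symm, n12.symm, n13.symm, n21.symm, n22.symm, n23.symm,
          n31.symm, n32.symm, n33.symm])).1 hord
      simp [h]
  · rintro (rfl | rfl | rfl | rfl | rfl | rfl)
    · refine ⟨7, 13, 14, 8, 9, 18, ?_⟩
      norm_num [hasSigns_hp6_iff]
      exact (hasOrder_iff_eq (a := 7) (b := 8) (c := 9) (d := 13) (e := 14) (f := 18)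
        (by norm_num) (by norm_num) (by norm_num) (by norm_num) (by norm_num)
        (by ext; simp only [Set.mem_insert_iff, Set.mem_singleton_iff]; tauto)
        (by simp [Fin.forall_fin_succ])).2 rfl
    · refine ⟨4, 5, 6, 1, 7, 8, ?_⟩
      norm_num [hasSigns_hp6_iff]
      exact (hasOrder_iff_eq (a := 1) (b := 4) (c := 5) (d := 6) (e := 7) (f := 8)
        (by norm_num) (by norm_num) (by norm_num) (by norm_num) (by norm_num)
        (by ext; simp only [Set.mem_insert_iff, Set.mem_singleton_iff]; tauto)
        (by simp [Fin.forall_fin_succ])).2 rfl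
    · refine ⟨3, 4, 6, 1, 5, 8, ?_⟩
      norm_num [hasSigns_hp6_iff]
      exact (hasOrder_iff_eq (a := 1) (b := 3) (c := 4) (d := 5) (e := 6) (f := 8)
        (by norm_num) (by norm_num) (by norm_num) (by norm_num) (by norm_num)
        (by ext; simp only [Set.mem_insert_iff, Set.mem_singleton_iff]; tauto)
        (by simp [Fin.forall_fin_succ])).2 rfl
    · refine ⟨5, 7, 15, 1, 13, 14, ?_⟩
      norm_num [hasSigns_hp6_iff]
      exact (hasOrder_iff_eq (a := 1) (b := 5) (c := 7) (d := 13) (e := 14) (f := 15)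
        (by norm_num) (by norm_num) (by norm_num) (by norm_num) (by norm_num)
        (by ext; simp only [Set.mem_insert_iff, Set.mem_singleton_iff]; tauto)
        (by simp [Fin.forall_fin_succ])).2 rfl
    · refine ⟨2, 4, 5, 1, 3, 8, ?_⟩
      norm_num [hasSigns_hp6_iff]
      exact (hasOrder_iff_eq (a := 1) (b := 2) (c := 3) (d := 4) (e := 5) (f := 8)
        (by norm_num) (by norm_num) (by norm_num) (by norm_num) (by norm_num)
        (by ext; simp only [Set.mem_insert_iff, Set.mem_singleton_iff]; tauto)
        (by simp [Fin.forall_fin_succ])).2 rfl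
    · refine ⟨3, 4, 5, 1, 2, 10, ?_⟩
      norm_num [hasSigns_hp6_iff]
      exact (hasOrder_iff_eq (a := 1) (b := 2) (c := 3) (d := 4) (e := 5) (f := 10)
        (by norm_num) (by norm_num) (by norm_num) (by norm_num) (by norm_num)
        (by ext; simp only [Set.mem_insert_iff, Set.mem_singleton_iff]; tauto)
        (by simp [Fin.forall_fin_succ])).2 rfl
end

section
/- Let P(x) = (x−α1)(x−α2)(x−α3)(x+γ1)(x+γ2)(x+γ3) be a monic degree-6 hyperbolic polynomial with 0 < α1 < α2 < α3, 0 < γ1 < γ2 < γ3, and all six moduli pairwise distinct. If the coefficient signs of P are (+,+,+,−,+,+,−) (the sign pattern Σ_{3,1,2,1}) or (+,+,+,−,−,+,−) (the sign pattern Σ_{3,2,1,1}), then γ3 > α3; in other words, the root of largest modulus is negative, so none of the ten orders of moduli ending with the letter P can occur with either of these two sign patterns. -/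
open Polynomial

theorem hp6_expand (α1 α2 α3 γ1 γ2 γ3 : ℝ) :
    ∃ c0 c1 c2 c3 : ℝ, hp6 α1 α2 α3 γ1 γ2 γ3 = X ^ 6
      + C (γ1 + γ2 + γ3 - (α1 + α2 + α3)) * X ^ 5
      + C (γ1 * γ2 + γ1 * γ3 + γ2 * γ3 + (α1 * α2 + α1 * α3 + α2 * α3)
          - (α1 + α2 + α3) * (γ1 + γ2 + γ3)) * X ^ 4
      + C c3 * X ^ 3 + C c2 * X ^ 2 + C c1 * X + C c0 := by
  refine ⟨-(α1 * α2 * α3 * (γ1 * γ2 * γ3)),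
    (α1 * α2 + α1 * α3 + α2 * α3) * (γ1 * γ2 * γ3)
      - α1 * α2 * α3 * (γ1 * γ2 + γ1 * γ3 + γ2 * γ3),
    (α1 * α2 + α1 * α3 + α2 * α3) * (γ1 * γ2 + γ1 * γ3 + γ2 * γ3)
      - (α1 + α2 + α3) * (γ1 * γ2 * γ3) - α1 * α2 * α3 * (γ1 + γ2 + γ3),
    γ1 * γ2 * γ3 - (α1 + α2 + α3) * (γ1 * γ2 + γ1 * γ3 + γ2 * γ3)
      + (α1 * α2 + α1 * α3 + α2 * α3) * (γ1 + γ2 + γ3) - α1 * α2 * α3, ?_⟩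
  simp only [hp6, map_add, map_sub, map_mul, map_neg]
  ring

theorem hp6_coeff_five (α1 α2 α3 γ1 γ2 γ3 : ℝ) :
    (hp6 α1 α2 α3 γ1 γ2 γ3).coeff 5 = γ1 + γ2 + γ3 - (α1 + α2 + α3) := by
  obtain ⟨c0, c1, c2, c3, h⟩ := hp6_expand α1 α2 α3 γ1 γ2 γ3
  simp only [h, coeff_add, coeff_C_mul, coeff_X_pow, coeff_X, coeff_C]
  norm_num

theorem hp6_coeff_four (α1 α2 α3 γ1 γ2 γ3 : ℝ) :
    (hp6 α1 α2 α3 γ1 γ2 γ3).coeff 4 =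
      γ1 * γ2 + γ1 * γ3 + γ2 * γ3 + (α1 * α2 + α1 * α3 + α2 * α3)
        - (α1 + α2 + α3) * (γ1 + γ2 + γ3) := by
  obtain ⟨c0, c1, c2, c3, h⟩ := hp6_expand α1 α2 α3 γ1 γ2 γ3
  simp only [h, coeff_add, coeff_C_mul, coeff_X_pow, coeff_X, coeff_C]
  norm_num

/-- If the coefficients of degrees 5 and 4 are positive, then the largest modulus cannot belong to a positive root. -/
theorem lt_of_coeff_five_pos_of_coeff_four_pos {α1 α2 α3 γ1 γ2 γ3 : ℝ}
    (hα1 : 0 < α1) (hα2 : 0 < α2)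
    (hγ1 : 0 < γ1) (hγ12 : γ1 < γ2) (hγ23 : γ2 < γ3)
    (h5 : 0 < (hp6 α1 α2 α3 γ1 γ2 γ3).coeff 5) (h4 : 0 < (hp6 α1 α2 α3 γ1 γ2 γ3).coeff 4) :
    α3 < γ3 := by
  rw [hp6_coeff_five] at h5
  rw [hp6_coeff_four] at h4
  by_contra! h
  have hsq : (γ1 + γ2 + γ3 - (α1 + α2 + α3)) ^ 2 ≤ (γ1 + γ2 + γ3 - α3) ^ 2 :=
    pow_le_pow_left₀ h5.le (by linarith) 2
  have hsum : 0 ≤ (γ1 + γ2 + γ3) * (3 * α3 - (γ1 + γ2 + γ3)) :=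
    mul_nonneg (by linarith) (by linarith)
  nlinarith [sq_nonneg (γ1 - γ2), sq_nonneg (γ1 - γ3), sq_nonneg (γ2 - γ3),
    sq_nonneg α1, sq_nonneg α2]

/-- If the coefficient signs of `hp6 α1 α2 α3 γ1 γ2 γ3` form the sign pattern
`Σ_{3,1,2,1} = (+,+,+,-,+,+,-)` or `Σ_{3,2,1,1} = (+,+,+,-,-,+,-)`, then the root of
largest modulus is negative: `γ3 > α3`. -/
theorem largest_modulus_negative (α1 α2 α3 γ1 γ2 γ3 : ℝ)
    (hα1 : 0 < α1) (hα12 : α1 < α2) (hα23 : α2 < α3)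
    (hγ1 : 0 < γ1) (hγ12 : γ1 < γ2) (hγ23 : γ2 < γ3)
    (h11 : α1 ≠ γ1) (h12 : α1 ≠ γ2) (h13 : α1 ≠ γ3)
    (h21 : α2 ≠ γ1) (h22 : α2 ≠ γ2) (h23 : α2 ≠ γ3)
    (h31 : α3 ≠ γ1) (h32 : α3 ≠ γ2) (h33 : α3 ≠ γ3)
    (hsigns :
      (0 < (hp6 α1 α2 α3 γ1 γ2 γ3).coeff 6 ∧ 0 < (hp6 α1 α2 α3 γ1 γ2 γ3).coeff 5 ∧
       0 < (hp6 α1 α2 α3 γ1 γ2 γ3).coeff 4 ∧ (hp6 α1 α2 α3 γ1 γ2 γ3).coeff 3 < 0 ∧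
       0 < (hp6 α1 α2 α3 γ1 γ2 γ3).coeff 2 ∧ 0 < (hp6 α1 α2 α3 γ1 γ2 γ3).coeff 1 ∧
       (hp6 α1 α2 α3 γ1 γ2 γ3).coeff 0 < 0) ∨
      (0 < (hp6 α1 α2 α3 γ1 γ2 γ3).coeff 6 ∧ 0 < (hp6 α1 α2 α3 γ1 γ2 γ3).coeff 5 ∧
       0 < (hp6 α1 α2 α3 γ1 γ2 γ3).coeff 4 ∧ (hp6 α1 α2 α3 γ1 γ2 γ3).coeff 3 < 0 ∧
       (hp6 α1 α2 α3 γ1 γ2 γ3).coeff 2 < 0 ∧ 0 < (hp6 α1 α2 α3 γ1 γ2 γ3).coeff 1 ∧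
       (hp6 α1 α2 α3 γ1 γ2 γ3).coeff 0 < 0)) :
    α3 < γ3 := by
  obtain ⟨-, h5, h4, -⟩ | ⟨-, h5, h4, -⟩ := hsigns
  all_goals
    exact lt_of_coeff_five_pos_of_coeff_four_pos hα1 (hα1.trans hα12)
      hγ1 hγ12 hγ23 h5 h4
end
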